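/- arXiv:2309.08130 — 8 statements merged into one kernel-verified Lean document; each statement's English description precedes it below -/
import Mathlib

section
/- Let G be a real Hilbert space, K ⊆ G a nonempty convex set, and φ : G → ℝ a convex continuous function. Then for u ∈ K, u minimizes φ over K (i.e., φ(u) ≤ φ(v) for all v ∈ K) if and only if there exists g ∈ G such that g is a subgradient of φ at u and ⟨g, v − u⟩ ≥ 0 for all v ∈ K. -/
open scoped RealInnerProductSpace

/-- `g` is a subgradient of `φ` at `u`: `φ w - φ u ≥ ⟪g, w - u⟫` for all `w`. -/
def HasSubgradientAt {E : Type*} [NormedAddCommGroup E] [InnerProductSpace ℝ E]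
    (φ : E → ℝ) (g u : E) : Prop :=
  ∀ w, φ u + ⟪g, w - u⟫ ≤ φ w

/-- For a convex continuous `φ` on a real Hilbert space and a nonempty convex set `K`,
`u ∈ K` minimizes `φ` over `K` iff there is a subgradient `g` of `φ` at `u` with
`⟪g, v - u⟫ ≥ 0` for all `v ∈ K`. -/
theorem minimizer_iff_exists_subgradient
    {G : Type*} [NormedAddCommGroup G] [InnerProductSpace ℝ G] [CompleteSpace G]
    (K : Set G) (hne : K.Nonempty) (hKconv : Convex ℝ K)
    (φ : G → ℝ) (hφ : ConvexOn ℝ Set.univ φ) (hφc : Continuous φ)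
    (u : G) (hu : u ∈ K) :
    (∀ v ∈ K, φ u ≤ φ v) ↔
      ∃ g : G, HasSubgradientAt φ g u ∧ ∀ v ∈ K, 0 ≤ ⟪g, v - u⟫ := by
  constructor
  · intro hmin
    have hdisj : Disjoint {p : G × ℝ | p.1 ∈ Set.univ ∧ φ p.1 < p.2} (K ×ˢ Set.Iic (φ u)) := by
      rw [Set.disjoint_left]
      rintro ⟨v, t⟩ ⟨-, hvt⟩ ⟨hv, ht⟩
      exact absurd (hmin v hv) (not_le.2 (lt_of_lt_of_le hvt ht))
    have hopen : IsOpen {p : G × ℝ | p.1 ∈ Set.univ ∧ φ p.1 < p.2} := by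
      simpa using isOpen_lt (hφc.comp continuous_fst) continuous_snd
    obtain ⟨f, c, hf_lt, hf_ge⟩ := geometric_hahn_banach_open hφ.convex_strict_epigraph hopen
      (hKconv.prod (convex_Iic (φ u))) hdisj
    set l : G →L[ℝ] ℝ := f.comp (ContinuousLinearMap.inl ℝ G ℝ)
    set a : ℝ := f (0, 1)
    have hf (w : G) (t : ℝ) : f (w, t) = l w + t * a := by
      have hwt : ((w, t) : G × ℝ) = (w, 0) + t • (0, 1) := by simp
      rw [hwt, map_add, map_smul, smul_eq_mul]
      rfl
    have hlt (w : G) (t : ℝ) (hwt : φ w < t) : l w + t * a < c :=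
      hf w t ▸ hf_lt (w, t) ⟨Set.mem_univ w, hwt⟩
    have hge (v : G) (hv : v ∈ K) : c ≤ l v + φ u * a :=
      hf v (φ u) ▸ hf_ge (v, φ u) ⟨hv, Set.mem_Iic.2 le_rfl⟩
    have ha_neg : a < 0 := by
      linarith [hlt u (φ u + 1) (lt_add_one _), hge u hu]
    have hle (w : G) : l w + φ w * a ≤ c := by
      have hcont : Continuous fun t : ℝ => l w + t * a := by fun_prop
      refine le_of_tendsto (x := nhdsWithin (φ w) (Set.Ioi (φ w)))
        (hcont.continuousWithinAt (x := φ w)) ?_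
      filter_upwards [self_mem_nhdsWithin] with t ht using (hlt w t ht).le
    refine ⟨(-a)⁻¹ • (InnerProductSpace.toDual ℝ G).symm l, fun w => ?_, fun v hv => ?_⟩
    · rw [real_inner_smul_left, InnerProductSpace.toDual_symm_apply, map_sub,
        ← le_sub_iff_add_le', inv_mul_le_iff₀ (neg_pos.2 ha_neg)]
      linarith [hle w, hge u hu]
    · rw [real_inner_smul_left, InnerProductSpace.toDual_symm_apply, map_sub]
      exact mul_nonneg (inv_nonneg.2 (neg_nonneg.2 ha_neg.le)) (by linarith [hle u, hge v hv])
  · rintro ⟨g, hg, hgK⟩ v hv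
    linarith [hg v, hgK v hv]
end

section
/- Let (Ω, μ) be a finite measure space and let u, λ ∈ L²(μ) (real-valued). Define j₂ : L²(μ) → ℝ by j₂(w) = ∫ |w| dμ. Then λ is a subgradient of j₂ at u (i.e., j₂(w) − j₂(u) ≥ ⟨λ, w − u⟩_{L²} for all w ∈ L²(μ)) if and only if for μ-almost every x: λ(x) = 1 whenever u(x) > 0, λ(x) = −1 whenever u(x) < 0, and λ(x) ∈ [−1, 1] whenever u(x) = 0. -/
open MeasureTheory
open scoped RealInnerProductSpace

theorem abs_mul_characterization (a b : ℝ) :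
    ((0 < a → b = 1) ∧ (a < 0 → b = -1) ∧ (a = 0 → b ∈ Set.Icc (-1 : ℝ) 1)) ↔
      |b| ≤ 1 ∧ b * a = |a| := by
  rw [abs_le]
  rcases lt_trichotomy a 0 with ha | rfl | ha
  · have hiff : b * a = |a| ↔ b = -1 := by
      rw [abs_of_neg ha, ← neg_one_mul a, mul_left_inj' ha.ne]
    rw [hiff]
    simp only [ha, ha.ne, ha.not_gt, false_imp_iff, true_imp_iff, true_and, and_true]
    constructor
    · rintro rfl; norm_num
    · exact fun h => h.2
  · simp
  · have hiff : b * a = |a| ↔ b = 1 := by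
      rw [abs_of_pos ha, mul_eq_right₀ ha.ne']
    rw [hiff]
    simp only [ha, ha.ne', ha.not_gt, false_imp_iff, true_imp_iff, and_true]
    constructor
    · rintro rfl; norm_num
    · exact fun h => h.2

/-- For a positively homogeneous functional, a subgradient at `u` supports it at `0` and attains
the value of the functional at `u`. -/
theorem HasSubgradientAt.of_posHomogeneous {E : Type*} [NormedAddCommGroup E]
    [InnerProductSpace ℝ E] {φ : E → ℝ} {g u : E}
    (hφ : ∀ c : ℝ, 0 ≤ c → φ (c • u) = c * φ u) (h : HasSubgradientAt φ g u) :
    ⟪g, u⟫ = φ u ∧ ∀ w, ⟪g, w⟫ ≤ φ w := by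
  have h₀ := h ((0 : ℝ) • u)
  have h₂ := h ((2 : ℝ) • u)
  rw [hφ _ le_rfl, inner_sub_right, real_inner_smul_right] at h₀
  rw [hφ _ zero_le_two, inner_sub_right, real_inner_smul_right] at h₂
  have hu : ⟪g, u⟫ = φ u := by linarith
  refine ⟨hu, fun w => ?_⟩
  have hw := h w
  rw [inner_sub_right] at hw
  linarith

section L2

variable {Ω : Type*} [MeasurableSpace Ω] {μ : Measure Ω}

theorem integrable_mul_coeFn_L2 (f g : Lp ℝ 2 μ) : Integrable (fun x => f x * g x) μ :=
  (Lp.memLp f).integrable_mul (Lp.memLp g)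

theorem inner_L2_eq_integral_mul (f g : Lp ℝ 2 μ) : ⟪f, g⟫ = ∫ x, f x * g x ∂μ := by
  rw [L2.inner_def]
  refine integral_congr_ae (.of_forall fun x => ?_)
  simp [mul_comm]

theorem integral_abs_smul_L2 (c : ℝ) (f : Lp ℝ 2 μ) :
    ∫ x, |(c • f : Lp ℝ 2 μ) x| ∂μ = |c| * ∫ x, |f x| ∂μ := by
  rw [← integral_const_mul]
  refine integral_congr_ae ?_
  filter_upwards [Lp.coeFn_smul c f] with x hx
  rw [hx, Pi.smul_apply, smul_eq_mul, abs_mul]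

theorem integral_abs_indicatorConstLp_one {s : Set Ω} (hs : MeasurableSet s) (hμs : μ s ≠ ⊤) :
    ∫ x, |(indicatorConstLp 2 hs hμs (1 : ℝ)) x| ∂μ = μ.real s := by
  rw [← integral_indicator_one hs]
  refine integral_congr_ae ?_
  filter_upwards [indicatorConstLp_coeFn (p := 2) (hs := hs) (hμs := hμs) (c := (1 : ℝ))] with x hx
  rw [hx]
  by_cases h : x ∈ s <;> simp [h]

theorem ae_abs_le_one_of_inner_le_integral_abs [IsFiniteMeasure μ] {g : Lp ℝ 2 μ}
    (h : ∀ w : Lp ℝ 2 μ, ⟪g, w⟫ ≤ ∫ x, |w x| ∂μ) : ∀ᵐ x ∂μ, |g x| ≤ 1 := by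
  have hg : Integrable g μ := (Lp.memLp g).integrable one_le_two
  have hset : ∀ (c : ℝ) (s : Set Ω), MeasurableSet s →
      c * ∫ x in s, g x ∂μ ≤ |c| * μ.real s := by
    intro c s hs
    have := h (c • indicatorConstLp 2 hs (measure_ne_top μ s) (1 : ℝ))
    rwa [integral_abs_smul_L2, integral_abs_indicatorConstLp_one, real_inner_smul_right,
      real_inner_comm, L2.inner_indicatorConstLp_one] at this
  have hle : g ≤ᵐ[μ] fun _ => (1 : ℝ) := by
    refine ae_le_of_forall_setIntegral_le hg (integrable_const 1) fun s hs _ => ?_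
    simpa using hset 1 s hs
  have hge : (fun _ => (-1 : ℝ)) ≤ᵐ[μ] g := by
    refine ae_le_of_forall_setIntegral_le (integrable_const (-1)) hg fun s hs _ => ?_
    have := hset (-1) s hs
    simp only [abs_neg, abs_one, one_mul, neg_mul] at this
    simp only [setIntegral_const, smul_eq_mul]
    linarith
  filter_upwards [hle, hge] with x h₁ h₂
  exact abs_le.2 ⟨h₂, h₁⟩

end L2

/-- Characterization of the subdifferential of the `L¹`-norm functional
`j₂ w = ∫ |w| dμ` on `L²(μ)` for a finite measure `μ`:  `λ ∈ ∂j₂(u)` iff a.e.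
`λ = 1` where `u > 0`, `λ = -1` where `u < 0`, and `λ ∈ [-1,1]` where `u = 0`. -/
theorem hasSubgradientAt_L1norm_iff
    {Ω : Type*} [MeasurableSpace Ω] (μ : Measure Ω) [IsFiniteMeasure μ]
    (u lam : Lp ℝ 2 μ) :
    HasSubgradientAt (fun w : Lp ℝ 2 μ => ∫ x, |w x| ∂μ) lam u ↔
      ∀ᵐ x ∂μ, (0 < u x → lam x = 1) ∧ (u x < 0 → lam x = -1) ∧
        (u x = 0 → lam x ∈ Set.Icc (-1 : ℝ) 1) := by
  have habs : ∀ w : Lp ℝ 2 μ, Integrable (fun x => |w x|) μ := fun w =>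
    ((Lp.memLp w).integrable one_le_two).abs
  simp only [abs_mul_characterization]
  have hle : (∀ᵐ x ∂μ, |lam x| ≤ 1) → ∀ w : Lp ℝ 2 μ, ∀ᵐ x ∂μ, lam x * w x ≤ |w x| := by
    intro h w
    filter_upwards [h] with x hx
    calc lam x * w x ≤ |lam x| * |w x| := (le_abs_self _).trans_eq (abs_mul _ _)
      _ ≤ |w x| := mul_le_of_le_one_left (abs_nonneg _) hx
  constructor
  · intro h
    obtain ⟨hu, hw⟩ := h.of_posHomogeneous fun c hc => by
      simp only [integral_abs_smul_L2, abs_of_nonneg hc]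
    have hlam := ae_abs_le_one_of_inner_le_integral_abs hw
    rw [inner_L2_eq_integral_mul] at hu
    exact hlam.and ((integral_eq_iff_of_ae_le (integrable_mul_coeFn_L2 lam u) (habs u)
      (hle hlam u)).1 hu)
  · intro h w
    have hu : ⟪lam, u⟫ = ∫ x, |u x| ∂μ := by
      rw [inner_L2_eq_integral_mul]
      exact integral_congr_ae (h.mono fun _ hx => hx.2)
    have hw : ⟪lam, w⟫ ≤ ∫ x, |w x| ∂μ := by
      rw [inner_L2_eq_integral_mul]
      exact integral_mono_ae (integrable_mul_coeFn_L2 lam w) (habs w)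
        (hle (h.mono fun _ hx => hx.1) w)
    simp only [inner_sub_right]
    linarith
end

section
/- Let (Ω, μ) be a finite measure space, a < 0 < b real numbers, U_ad := {v ∈ L²(μ) : a ≤ v(x) ≤ b for μ-a.e. x}, S : L²(μ) → L²(μ) a continuous linear map, f, y_d ∈ L²(μ), and γ, β > 0. Define Ĵ(u) := (1/2)·‖S(u + f) − y_d‖² + (γ/2)·‖u‖² + β·∫ |u| dμ. If u ∈ U_ad satisfies Ĵ(u) ≤ Ĵ(v) for all v ∈ U_ad, then there exists λ ∈ L²(μ) such that (i) for μ-a.e. x: λ(x) = 1 whenever u(x) > 0, λ(x) = −1 whenever u(x) < 0, and λ(x) ∈ [−1, 1] whenever u(x) = 0; and (ii) ⟨p + γ·u + β·λ, v − u⟩ ≥ 0 for all v ∈ U_ad, where p := S*(S(u + f) − y_d) and S* is the adjoint of S. -/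
open MeasureTheory
open scoped RealInnerProductSpace

/-- If `u` minimizes the quadratic part plus a functional `j` that is convex on the segment from
`u` to `v`, then the variational inequality in the direction `v - u` holds. -/
lemma variational_inequality_of_minimizes {H K : Type*}
    [NormedAddCommGroup H] [InnerProductSpace ℝ H] [CompleteSpace H]
    [NormedAddCommGroup K] [InnerProductSpace ℝ K] [CompleteSpace K]
    (S : H →L[ℝ] K) (f : H) (yd : K) (γ : ℝ) (j : H → ℝ) (u v : H)
    (hj : ∀ t : ℝ, 0 < t → t ≤ 1 → j (u + t • (v - u)) ≤ j u + t * (j v - j u))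
    (hmin : ∀ t : ℝ, 0 < t → t ≤ 1 →
      (1 / 2) * ‖S (u + f) - yd‖ ^ 2 + (γ / 2) * ‖u‖ ^ 2 + j u ≤
        (1 / 2) * ‖S (u + t • (v - u) + f) - yd‖ ^ 2 + (γ / 2) * ‖u + t • (v - u)‖ ^ 2
          + j (u + t • (v - u))) :
    0 ≤ ⟪(ContinuousLinearMap.adjoint S) (S (u + f) - yd) + γ • u, v - u⟫ + (j v - j u) := by
  set d := v - u
  set A := ⟪(ContinuousLinearMap.adjoint S) (S (u + f) - yd) + γ • u, d⟫ + (j v - j u) with hA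
  set C := (1 / 2) * ‖S d‖ ^ 2 + (γ / 2) * ‖d‖ ^ 2 with hC
  have hineq : ∀ t : ℝ, 0 < t → t ≤ 1 → 0 ≤ A + t * C := by
    intro t ht ht1
    have hS : S (u + t • d + f) - yd = (S (u + f) - yd) + t • S d := by
      simp only [map_add, map_smul]; abel
    have h := hmin t ht ht1
    have h' := hj t ht ht1
    rw [hS, norm_add_sq_real, norm_add_sq_real, inner_smul_right, inner_smul_right, norm_smul,
      norm_smul, mul_pow, mul_pow, Real.norm_eq_abs, sq_abs] at h
    rw [inner_add_left, ContinuousLinearMap.adjoint_inner_left, real_inner_smul_left] at hA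
    refine nonneg_of_mul_nonneg_right (a := t) ?_ ht
    rw [hA, hC]
    linarith
  have hlim : Filter.Tendsto (fun t : ℝ => A + t * C) (nhdsWithin 0 (Set.Ioi 0)) (nhds A) := by
    have hcont : Continuous fun t : ℝ => A + t * C := by fun_prop
    simpa using (hcont.tendsto 0).mono_left nhdsWithin_le_nhds
  refine ge_of_tendsto hlim ?_
  filter_upwards [Ioc_mem_nhdsGT (zero_lt_one (α := ℝ))] with t ht
  exact hineq t ht.1 ht.2

/-- The functional `w ↦ ∫ |w|` is convex along segments in `L²` of a finite measure. -/
lemma integral_abs_add_smul_sub_le {Ω : Type*} [MeasurableSpace Ω] {μ : Measure Ω}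
    [IsFiniteMeasure μ] (u v : Lp ℝ 2 μ) {t : ℝ} (ht : 0 ≤ t) (ht1 : t ≤ 1) :
    ∫ x, |(u + t • (v - u)) x| ∂μ ≤
      ∫ x, |u x| ∂μ + t * (∫ x, |v x| ∂μ - ∫ x, |u x| ∂μ) := by
  have hint : ∀ w : Lp ℝ 2 μ, Integrable (fun x => |w x|) μ := fun w =>
    ((Lp.memLp w).integrable (by norm_num)).abs
  have hdiff : Integrable (fun x => t * (|v x| - |u x|)) μ := ((hint v).sub (hint u)).const_mul t
  rw [← integral_sub (hint v) (hint u), ← integral_const_mul, ← integral_add (hint u) hdiff]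
  refine integral_mono_ae (hint _) ((hint u).add hdiff) ?_
  filter_upwards [Lp.coeFn_add u (t • (v - u)), Lp.coeFn_smul t (v - u), Lp.coeFn_sub v u]
    with x h1 h2 h3
  simp only [h1, h2, h3, Pi.add_apply, Pi.smul_apply, Pi.sub_apply, smul_eq_mul]
  calc |u x + t * (v x - u x)| = |(1 - t) * u x + t * v x| := by ring_nf
    _ ≤ |(1 - t) * u x| + |t * v x| := abs_add_le _ _
    _ = |u x| + t * (|v x| - |u x|) := by
      rw [abs_mul, abs_mul, abs_of_nonneg ht, abs_of_nonneg (sub_nonneg.2 ht1)]; ring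

/-- An integral variational inequality over a box constraint localizes to an almost everywhere
inequality. -/
lemma ae_nonneg_of_variational_inequality {Ω : Type*} [MeasurableSpace Ω] {μ : Measure Ω}
    [IsFiniteMeasure μ] {a b β : ℝ} {g u : Lp ℝ 2 μ}
    (hu : ∀ᵐ x ∂μ, a ≤ u x ∧ u x ≤ b)
    (hVI : ∀ v : Lp ℝ 2 μ, (∀ᵐ x ∂μ, a ≤ v x ∧ v x ≤ b) →
      0 ≤ ⟪g, v - u⟫ + (β * ∫ x, |v x| ∂μ - β * ∫ x, |u x| ∂μ))
    {v : Ω → ℝ} (hvL : MemLp v 2 μ) (hv : ∀ᵐ x ∂μ, a ≤ v x ∧ v x ≤ b) :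
    ∀ᵐ x ∂μ, 0 ≤ g x * (v x - u x) + β * (|v x| - |u x|) := by
  classical
  have habs : ∀ {w : Ω → ℝ}, MemLp w 2 μ → Integrable (fun x => |w x|) μ := fun hw =>
    (hw.integrable (by norm_num)).abs
  have hmul : ∀ {w : Ω → ℝ}, MemLp w 2 μ → Integrable (fun x => g x * (w x - u x)) μ :=
    fun hw => (Lp.memLp g).integrable_mul (hw.sub (Lp.memLp u))
  have hdiff : ∀ {w : Ω → ℝ}, MemLp w 2 μ → Integrable (fun x => β * (|w x| - |u x|)) μ :=
    fun hw => ((habs hw).sub (habs (Lp.memLp u))).const_mul β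
  refine ae_nonneg_of_forall_setIntegral_nonneg ((hmul hvL).add (hdiff hvL)) fun s hs _ => ?_
  have hwL : MemLp (s.piecewise v u) 2 μ :=
    MemLp.piecewise hs (hvL.restrict s) ((Lp.memLp u).restrict sᶜ)
  have hw := hVI (hwL.toLp _) (by
    filter_upwards [hwL.coeFn_toLp, hu, hv] with x h1 h2 h3
    rw [h1]
    by_cases hx : x ∈ s <;> simpa [hx])
  have hinner : ⟪g, hwL.toLp _ - u⟫ = ∫ x, g x * (s.piecewise v u x - u x) ∂μ := by
    rw [L2.inner_def]
    refine integral_congr_ae ?_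
    filter_upwards [hwL.coeFn_toLp, Lp.coeFn_sub (hwL.toLp _) u] with x h1 h2
    simp only [h1, h2, Pi.sub_apply, RCLike.inner_apply, conj_trivial, mul_comm]
  have hnorm : ∫ x, |hwL.toLp _ x| ∂μ = ∫ x, |s.piecewise v u x| ∂μ := by
    refine integral_congr_ae ?_
    filter_upwards [hwL.coeFn_toLp] with x h1
    rw [h1]
  rw [hinner, hnorm, ← mul_sub, ← integral_sub (habs hwL) (habs (Lp.memLp u)),
    ← integral_const_mul, ← integral_add (hmul hwL) (hdiff hwL)] at hw
  rw [← integral_indicator hs]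
  refine hw.trans_eq (integral_congr_ae (.of_forall fun x => ?_))
  by_cases hx : x ∈ s <;> simp [hx]

/-- The subgradient of `|·|` at `r` closest to `c`. -/
noncomputable def absSubgradient (r c : ℝ) : ℝ :=
  if 0 < r then 1 else if r < 0 then -1 else max (-1) (min 1 c)

lemma abs_absSubgradient_le_one (r c : ℝ) : |absSubgradient r c| ≤ 1 := by
  unfold absSubgradient
  split_ifs <;> simp [abs_le]

lemma measurable_absSubgradient {Ω : Type*} [MeasurableSpace Ω] {r c : Ω → ℝ}
    (hr : Measurable r) (hc : Measurable c) :
    Measurable fun x => absSubgradient (r x) (c x) :=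
  Measurable.ite (measurableSet_lt measurable_const hr) measurable_const <|
    Measurable.ite (measurableSet_lt hr measurable_const) measurable_const <|
      measurable_const.max (measurable_const.min hc)

/-- Testing the scalar variational inequality with `a`, `b`, `0` and `s` gives the first-order
condition in the direction `s - r`. -/
lemma add_mul_absSubgradient_mul_sub_nonneg {a b β r s g : ℝ} (ha : a < 0) (hb : 0 < b)
    (hβ : 0 < β) (h_a : 0 ≤ g * (a - r) + β * (|a| - |r|))
    (h_b : 0 ≤ g * (b - r) + β * (|b| - |r|)) (h_zero : 0 ≤ g * (0 - r) + β * (|0| - |r|))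
    (h_s : 0 ≤ g * (s - r) + β * (|s| - |r|)) :
    0 ≤ (g + β * absSubgradient r (-g / β)) * (s - r) := by
  unfold absSubgradient
  rw [abs_of_neg ha] at h_a
  rw [abs_of_pos hb] at h_b
  rw [abs_zero] at h_zero
  rcases lt_trichotomy r 0 with hr | rfl | hr
  · rw [if_neg hr.not_gt, if_pos hr]
    rw [abs_of_neg hr] at h_zero h_s
    rcases le_total s 0 with hs | hs
    · rw [abs_of_nonpos hs] at h_s
      linarith
    · have : 0 ≤ g - β := by
        by_contra! h
        nlinarith
      nlinarith
  · have h1 : g ≤ β := by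
      by_contra! h
      simp only [abs_zero] at h_a
      nlinarith
    have h2 : -β ≤ g := by
      by_contra! h
      simp only [abs_zero] at h_b
      nlinarith
    have h3 : -g / β ≤ 1 := by rw [div_le_one hβ]; linarith
    have h4 : -1 ≤ -g / β := by rw [le_div_iff₀ hβ]; linarith
    rw [if_neg (lt_irrefl _), if_neg (lt_irrefl _), min_eq_right h3, max_eq_right h4,
      mul_div_cancel₀ _ hβ.ne']
    simp
  · rw [if_pos hr]
    rw [abs_of_pos hr] at h_zero h_s
    rcases le_total 0 s with hs | hs
    · rw [abs_of_nonneg hs] at h_s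
      linarith
    · have : g + β ≤ 0 := by
        by_contra! h
        nlinarith
      nlinarith

/-- First-order optimality conditions for the sparse optimal control problem: if `u`
minimizes `Ĵ(u) = ½‖S(u+f) - y_d‖² + (γ/2)‖u‖² + β∫|u|` over the admissible set
`U_ad = {v ∈ L²(μ) : a ≤ v ≤ b a.e.}`, then there is a subgradient `λ` of the `L¹` norm
at `u` such that `⟪p + γu + βλ, v - u⟫ ≥ 0` for all `v ∈ U_ad`, where
`p = S*(S(u+f) - y_d)`. -/
theorem sparse_control_first_order_optimality
    {Ω : Type*} [MeasurableSpace Ω] (μ : Measure Ω) [IsFiniteMeasure μ]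
    (a b : ℝ) (ha : a < 0) (hb : 0 < b)
    (Uad : Set (Lp ℝ 2 μ))
    (hUad : Uad = {v : Lp ℝ 2 μ | ∀ᵐ x ∂μ, a ≤ v x ∧ v x ≤ b})
    (S : Lp ℝ 2 μ →L[ℝ] Lp ℝ 2 μ) (f yd : Lp ℝ 2 μ)
    (γ β : ℝ) (hγ : 0 < γ) (hβ : 0 < β)
    (J : Lp ℝ 2 μ → ℝ)
    (hJ : J = fun u : Lp ℝ 2 μ =>
      (1 / 2) * ‖S (u + f) - yd‖ ^ 2 + (γ / 2) * ‖u‖ ^ 2 + β * ∫ x, |u x| ∂μ)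
    (u : Lp ℝ 2 μ) (hu : u ∈ Uad) (hmin : ∀ v ∈ Uad, J u ≤ J v) :
    ∃ lam : Lp ℝ 2 μ,
      (∀ᵐ x ∂μ, (0 < u x → lam x = 1) ∧ (u x < 0 → lam x = -1) ∧
        (u x = 0 → lam x ∈ Set.Icc (-1 : ℝ) 1)) ∧
      ∀ v ∈ Uad,
        0 ≤ ⟪(ContinuousLinearMap.adjoint S) (S (u + f) - yd) + γ • u + β • lam, v - u⟫ := by
  subst hUad hJ
  simp only [Set.mem_ofPred_eq] at hu hmin ⊢
  set g : Lp ℝ 2 μ := (ContinuousLinearMap.adjoint S) (S (u + f) - yd) + γ • u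
  have hVI : ∀ v : Lp ℝ 2 μ, (∀ᵐ x ∂μ, a ≤ v x ∧ v x ≤ b) →
      0 ≤ ⟪g, v - u⟫ + (β * ∫ x, |v x| ∂μ - β * ∫ x, |u x| ∂μ) := by
    intro v hv
    refine variational_inequality_of_minimizes S f yd γ (fun w => β * ∫ x, |w x| ∂μ) u v ?_ ?_
    · intro t ht ht1
      have := mul_le_mul_of_nonneg_left (integral_abs_add_smul_sub_le u v ht.le ht1) hβ.le
      linarith
    · intro t ht ht1
      refine hmin _ ?_
      filter_upwards [Lp.coeFn_add u (t • (v - u)), Lp.coeFn_smul t (v - u), Lp.coeFn_sub v u,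
        hu, hv] with x h1 h2 h3 h4 h5
      simp only [h1, h2, h3, Pi.add_apply, Pi.smul_apply, Pi.sub_apply, smul_eq_mul]
      constructor <;> nlinarith
  have hlocal {v : Ω → ℝ} (hvL : MemLp v 2 μ) (hv : ∀ᵐ x ∂μ, a ≤ v x ∧ v x ≤ b) :=
    ae_nonneg_of_variational_inequality hu hVI hvL hv
  have hlamL : MemLp (fun x => absSubgradient (u x) (-g x / β)) 2 μ :=
    MemLp.of_bound (measurable_absSubgradient (Lp.stronglyMeasurable u).measurable
      ((Lp.stronglyMeasurable g).measurable.neg.div_const β)).aestronglyMeasurable 1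
      (.of_forall fun x => abs_absSubgradient_le_one _ _)
  refine ⟨hlamL.toLp _, ?_, fun v hv => ?_⟩
  · filter_upwards [hlamL.coeFn_toLp] with x hx
    rw [hx]
    refine ⟨fun h => if_pos h, fun h => ?_, fun _ => abs_le.1 (abs_absSubgradient_le_one _ _)⟩
    rw [absSubgradient, if_neg h.not_gt, if_pos h]
  · rw [L2.inner_def]
    refine integral_nonneg_of_ae ?_
    filter_upwards [hlamL.coeFn_toLp, Lp.coeFn_add g (β • hlamL.toLp _),
      Lp.coeFn_smul β (hlamL.toLp _), Lp.coeFn_sub v u,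
      hlocal (memLp_const a) (.of_forall fun _ => ⟨le_rfl, (ha.trans hb).le⟩),
      hlocal (memLp_const b) (.of_forall fun _ => ⟨(ha.trans hb).le, le_rfl⟩),
      hlocal (memLp_const 0) (.of_forall fun _ => ⟨ha.le, hb.le⟩),
      hlocal (Lp.memLp v) hv] with x h1 h2 h3 h4 h_a h_b h_zero h_v
    have h := add_mul_absSubgradient_mul_sub_nonneg ha hb hβ h_a h_b h_zero h_v
    simpa only [h1, h2, h3, h4, Pi.add_apply, Pi.sub_apply, Pi.smul_apply, Pi.zero_apply,
      smul_eq_mul, RCLike.inner_apply, conj_trivial, mul_comm] using h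
end

section
/- Let (Ω, μ) be a finite measure space, a < 0 < b real numbers, U_ad := {v ∈ L²(μ) : a ≤ v(x) ≤ b for μ-a.e. x}, and γ, β > 0. Suppose u ∈ U_ad and p, λ ∈ L²(μ) satisfy: (H1) for μ-a.e. x, λ(x) = 1 whenever u(x) > 0, λ(x) = −1 whenever u(x) < 0, and λ(x) ∈ [−1, 1] whenever u(x) = 0; and (H2) ⟨p + γ·u + β·λ, v − u⟩ ≥ 0 for all v ∈ U_ad. Then for μ-a.e. x: (i) u(x) = min(b, max(a, −(1/γ)·(p(x) + β·λ(x)))); (ii) |p(x)| ≤ β whenever u(x) = 0; (iii) λ(x) = min(1, max(−1, −(1/β)·p(x))). -/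
open MeasureTheory
open scoped RealInnerProductSpace

/-- The projection `s` of `t` onto `[a, b]` satisfies `(s - r)² ≤ (t - r) (s - r)` for every
`r ∈ [a, b]`. -/
lemma sq_sub_clamp_le {a b r : ℝ} (t : ℝ) (har : a ≤ r) (hrb : r ≤ b) :
    (min b (max a t) - r) ^ 2 ≤ (t - r) * (min b (max a t) - r) := by
  rcases le_total a t with h₁ | h₁
  · rcases le_total b t with h₂ | h₂
    · rw [max_eq_right h₁, min_eq_left h₂]
      nlinarith
    · rw [max_eq_right h₁, min_eq_right h₂, sq]
  · rw [max_eq_left h₁, min_eq_right (har.trans hrb)]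
    nlinarith

/-- If `u` solves the variational inequality `0 ≤ ⟪γ • (u - z), v - u⟫` over all `v` with values
in `[a, b]`, then `u` is a.e. the pointwise projection of `z` onto `[a, b]`. -/
lemma ae_eq_clamp_of_variational_inequality
    {Ω : Type*} [MeasurableSpace Ω] {μ : Measure Ω} [IsFiniteMeasure μ]
    {a b γ : ℝ} (hab : a ≤ b) (hγ : 0 < γ) {u z : Lp ℝ 2 μ}
    (hu : ∀ᵐ x ∂μ, a ≤ u x ∧ u x ≤ b)
    (H : ∀ v : Lp ℝ 2 μ, (∀ᵐ x ∂μ, a ≤ v x ∧ v x ≤ b) → 0 ≤ ⟪γ • (u - z), v - u⟫) :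
    ∀ᵐ x ∂μ, u x = min b (max a (z x)) := by
  have hbd (t : ℝ) : a ≤ min b (max a t) ∧ min b (max a t) ≤ b :=
    ⟨le_min hab (le_max_left _ _), min_le_left _ _⟩
  have hmem : MemLp (fun x => min b (max a (z x))) 2 μ := by
    refine MemLp.of_bound (C := max |a| |b|) ?_ (Filter.Eventually.of_forall fun x => ?_)
    · exact (by fun_prop : Continuous fun t : ℝ => min b (max a t)).comp_aestronglyMeasurable
        (Lp.aestronglyMeasurable z)
    · exact abs_le_max_abs_abs (hbd _).1 (hbd _).2
  set v : Lp ℝ 2 μ := hmem.toLp _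
  have hv : v =ᵐ[μ] fun x => min b (max a (z x)) := hmem.coeFn_toLp
  have hle : ⟪v - u, v - u⟫ ≤ ⟪z - u, v - u⟫ := by
    rw [L2.inner_def, L2.inner_def]
    refine integral_mono_ae (L2.integrable_inner _ _) (L2.integrable_inner _ _) ?_
    filter_upwards [hu, hv, Lp.coeFn_sub v u, Lp.coeFn_sub z u] with x hux hvx hvu hzu
    have := sq_sub_clamp_le (z x) hux.1 hux.2
    simp only [hvu, hzu, Pi.sub_apply, hvx, RCLike.inner_apply, conj_trivial]
    linarith
  have hvi := H v (hv.mono fun x hx => hx ▸ hbd (z x))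
  rw [real_inner_smul_left, ← neg_sub z u, inner_neg_left] at hvi
  have hzu : ⟪z - u, v - u⟫ ≤ 0 := by
    have := nonneg_of_mul_nonneg_right hvi hγ
    linarith
  have hvu : v = u := sub_eq_zero.mp <| real_inner_self_nonpos.mp (hle.trans hzu)
  rwa [hvu] at hv

/-- Projection formulas: if `u ∈ U_ad`, `λ` satisfies the a.e. sign conditions of a
subgradient of the `L¹` norm at `u`, and the variational inequality
`⟪p + γu + βλ, v - u⟫ ≥ 0` holds for all `v ∈ U_ad`, then a.e.
`u = Π_{[a,b]}(-(1/γ)(p + βλ))`, `|p| ≤ β` on `{u = 0}`, and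
`λ = Π_{[-1,1]}(-(1/β)p)`. -/
theorem sparse_control_projection_formulas
    {Ω : Type*} [MeasurableSpace Ω] (μ : Measure Ω) [IsFiniteMeasure μ]
    (a b : ℝ) (ha : a < 0) (hb : 0 < b) (γ β : ℝ) (hγ : 0 < γ) (hβ : 0 < β)
    (u p lam : Lp ℝ 2 μ)
    (hu : ∀ᵐ x ∂μ, a ≤ u x ∧ u x ≤ b)
    (H1 : ∀ᵐ x ∂μ, (0 < u x → lam x = 1) ∧ (u x < 0 → lam x = -1) ∧
      (u x = 0 → lam x ∈ Set.Icc (-1 : ℝ) 1))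
    (H2 : ∀ v : Lp ℝ 2 μ, (∀ᵐ x ∂μ, a ≤ v x ∧ v x ≤ b) →
      0 ≤ ⟪p + γ • u + β • lam, v - u⟫) :
    ∀ᵐ x ∂μ,
      u x = min b (max a (-(1 / γ) * (p x + β * lam x))) ∧
      (u x = 0 → |p x| ≤ β) ∧
      lam x = min 1 (max (-1) (-(1 / β) * p x)) := by
  have hz : p + γ • u + β • lam = γ • (u - (-(1 / γ)) • (p + β • lam)) := by
    rw [smul_sub, smul_smul, mul_neg, mul_one_div_cancel hγ.ne', neg_one_smul]
    abel
  have hproj := ae_eq_clamp_of_variational_inequality (ha.trans hb).le hγ hu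
    (fun v hv => hz ▸ H2 v hv)
  filter_upwards [hproj, H1, Lp.coeFn_smul (-(1 / γ)) (p + β • lam), Lp.coeFn_add p (β • lam),
    Lp.coeFn_smul β lam] with x hx h1 hs hadd hsm
  rw [hs, Pi.smul_apply, hadd, Pi.add_apply, hsm, Pi.smul_apply, smul_eq_mul, smul_eq_mul] at hx
  obtain ⟨hpos, hneg, hzero⟩ := h1
  refine ⟨hx, ?_⟩
  have hγ' : 0 < 1 / γ := one_div_pos.mpr hγ
  rcases lt_trichotomy (u x) 0 with h | h | h
  · have hlam := hneg h
    refine ⟨fun h0 => absurd h0 h.ne, ?_⟩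
    rw [hx, min_lt_iff, or_iff_right hb.not_gt, max_lt_iff, hlam] at h
    have hp : -(1 / β) * p x ≤ -1 := by
      have : β ≤ p x := by nlinarith [h.2]
      rw [neg_mul, neg_le_neg_iff, one_div_mul_eq_div, one_le_div hβ]
      exact this
    rw [hlam, max_eq_left hp, min_eq_right (by norm_num)]
  · obtain ⟨hl, hr⟩ := hzero h
    have hp : p x = -(β * lam x) := by
      rw [h] at hx
      have h0 : -(1 / γ) * (p x + β * lam x) = 0 := by
        rcases min_choice b (max a (-(1 / γ) * (p x + β * lam x))) with h' | h'
        · linarith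
        · rcases max_choice a (-(1 / γ) * (p x + β * lam x)) with h'' | h'' <;> linarith
      have := (mul_eq_zero.mp h0).resolve_left (neg_ne_zero.mpr hγ'.ne')
      linarith
    refine ⟨fun _ => ?_, ?_⟩
    · rw [hp, abs_neg, abs_mul, abs_of_pos hβ]
      exact mul_le_of_le_one_right hβ.le (abs_le.mpr ⟨hl, hr⟩)
    · have : -(1 / β) * p x = lam x := by
        rw [hp]
        field_simp
      rw [this, max_eq_right hl, min_eq_right hr]
  · have hlam := hpos h
    refine ⟨fun h0 => absurd h0 h.ne', ?_⟩
    rw [hx, lt_min_iff, lt_max_iff, or_iff_right ha.not_gt, hlam] at h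
    have hp : 1 ≤ -(1 / β) * p x := by
      have : β ≤ -p x := by nlinarith [h.2]
      rw [neg_mul_comm, one_div_mul_eq_div, one_le_div hβ]
      exact this
    rw [hlam, max_eq_right (by linarith), min_eq_left hp]
end

section
/- Let a < 0 < b and γ, β > 0 be real numbers, and let u, p, λ be real numbers satisfying: (i) λ = 1 if u > 0, λ = −1 if u < 0, and λ ∈ [−1, 1] if u = 0; and (ii) u = min(b, max(a, −(1/γ)·(p + β·λ))). Then λ = min(1, max(−1, −(1/β)·p)), and moreover u = 0 if and only if |p| ≤ β. -/
/-- Pointwise sparsity formulas: if `λ` satisfies the sign conditions of the `L¹`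
subdifferential at `u` and `u = Π_{[a,b]}(-(1/γ)(p + βλ))` with `a < 0 < b`,
`γ, β > 0`, then `λ = Π_{[-1,1]}(-(1/β)p)` and `u = 0 ↔ |p| ≤ β`. -/
theorem pointwise_lambda_projection_and_sparsity
    (a b γ β : ℝ) (ha : a < 0) (hb : 0 < b) (hγ : 0 < γ) (hβ : 0 < β)
    (u p lam : ℝ)
    (hlam1 : 0 < u → lam = 1) (hlam2 : u < 0 → lam = -1)
    (hlam3 : u = 0 → lam ∈ Set.Icc (-1 : ℝ) 1)
    (hu : u = min b (max a (-(1 / γ) * (p + β * lam)))) :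
    lam = min 1 (max (-1) (-(1 / β) * p)) ∧ (u = 0 ↔ |p| ≤ β) := by
  have hw : γ * (-(1 / γ) * (p + β * lam)) = -(p + β * lam) := by field_simp
  have hq : β * (-(1 / β) * p) = -p := by field_simp
  generalize -(1 / γ) * (p + β * lam) = w at hu hw
  generalize -(1 / β) * p = q at hq ⊢
  rcases lt_trichotomy u 0 with h | h | h
  · have hw0 : w < 0 := by grind
    obtain rfl := hlam2 h
    have hp : β < p := by nlinarith
    have hq1 : q < -1 := by nlinarith
    refine ⟨by grind, fun h0 => absurd h0 h.ne, fun hle => ?_⟩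
    exact absurd (le_of_abs_le hle) hp.not_ge
  · have hw0 : w = 0 := by grind
    obtain ⟨hl, hr⟩ := hlam3 h
    have hp : p = -(β * lam) := by rw [hw0] at hw; linarith
    have hql : q = lam := mul_left_cancel₀ hβ.ne' (by linarith)
    refine ⟨by grind, fun _ => abs_le.2 ⟨by nlinarith, by nlinarith⟩, fun _ => h⟩
  · have hw0 : 0 < w := by grind
    obtain rfl := hlam1 h
    have hp : p < -β := by nlinarith
    have hq1 : 1 < q := by nlinarith
    refine ⟨by grind, fun h0 => absurd h0 h.ne', fun hle => ?_⟩
    exact absurd (neg_le_of_abs_le hle) hp.not_ge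
end

section
/- (Aubin–Nitsche duality estimate) Let V and H be real Hilbert spaces, ι : V → H a continuous linear map, a : V → V → ℝ a bilinear form with |a(u, v)| ≤ M·‖u‖_V·‖v‖_V for all u, v ∈ V, and let V_h be a linear subspace of V. Let y ∈ V and y_h ∈ V_h satisfy the Galerkin orthogonality a(y − y_h, v) = 0 for all v ∈ V_h. Let Θ ≥ 0 and assume that for every g ∈ H there exists m_g ∈ V with a(w, m_g) = ⟨g, ι w⟩_H for all w ∈ V, and there exists χ ∈ V_h with ‖m_g − χ‖_V ≤ Θ·‖g‖_H. Then ‖ι(y − y_h)‖_H ≤ M·Θ·‖y − y_h‖_V. -/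
open scoped RealInnerProductSpace

/-- Aubin–Nitsche duality estimate: with Galerkin orthogonality for `y_h ∈ V_h` and an
approximable dual problem (for each `g ∈ H` a solution `m_g` of `a(w, m_g) = ⟪g, ι w⟫`
approximable in `V_h` to accuracy `Θ‖g‖`), one has `‖ι(y - y_h)‖_H ≤ M·Θ·‖y - y_h‖_V`. -/
theorem aubin_nitsche_duality
    {V H : Type*} [NormedAddCommGroup V] [InnerProductSpace ℝ V] [CompleteSpace V]
    [NormedAddCommGroup H] [InnerProductSpace ℝ H] [CompleteSpace H]
    (ι : V →L[ℝ] H) (a : V →ₗ[ℝ] V →ₗ[ℝ] ℝ) (M : ℝ)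
    (hbound : ∀ u v : V, |a u v| ≤ M * ‖u‖ * ‖v‖)
    (Vh : Submodule ℝ V) (y yh : V) (hyh : yh ∈ Vh)
    (horth : ∀ v ∈ Vh, a (y - yh) v = 0)
    (Θ : ℝ) (hΘ : 0 ≤ Θ)
    (hdual : ∀ g : H, ∃ m : V, (∀ w : V, a w m = ⟪g, ι w⟫) ∧
      ∃ χ ∈ Vh, ‖m - χ‖ ≤ Θ * ‖g‖) :
    ‖ι (y - yh)‖ ≤ M * Θ * ‖y - yh‖ := by
  generalize y - yh = e at horth ⊢
  have hMe : 0 ≤ M * ‖e‖ := by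
    rcases (norm_nonneg e).eq_or_lt with he | he
    · simp [← he]
    · exact nonneg_of_mul_nonneg_left ((abs_nonneg _).trans (hbound e e)) he
  obtain ⟨m, hm, χ, hχ, hmχ⟩ := hdual (ι e)
  have hsq : ‖ι e‖ * ‖ι e‖ ≤ M * Θ * ‖e‖ * ‖ι e‖ :=
    calc ‖ι e‖ * ‖ι e‖ = a e (m - χ) := by
          rw [map_sub (a e), horth χ hχ, sub_zero, hm, real_inner_self_eq_norm_mul_norm]
      _ ≤ M * ‖e‖ * ‖m - χ‖ := (le_abs_self _).trans (hbound _ _)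
      _ ≤ M * ‖e‖ * (Θ * ‖ι e‖) := by gcongr
      _ = M * Θ * ‖e‖ * ‖ι e‖ := by ring
  rcases (norm_nonneg (ι e)).eq_or_lt with h | h
  · rw [← h, mul_right_comm]
    exact mul_nonneg hMe hΘ
  · exact le_of_mul_le_mul_right hsq h
end

section
/- Let E be a real inner product space, K ⊆ E a convex set, j₂ : E → ℝ a convex function, γ > 0 and β ≥ 0. Suppose u, u_h ∈ K and p, p_h, λ, λ_h ∈ E satisfy: λ is a subgradient of j₂ at u; λ_h is a subgradient of j₂ at u_h; ⟨p + γ·u + β·λ, v − u⟩ ≥ 0 for all v ∈ K; and ⟨p_h + γ·u_h + β·λ_h, v − u_h⟩ ≥ 0 for all v ∈ K. Then γ·‖u − u_h‖² ≤ ⟨p − p_h, u_h − u⟩. -/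
open scoped RealInnerProductSpace

/-- Subgradients are monotone. -/
theorem HasSubgradientAt.inner_sub_nonpos {E : Type*} [NormedAddCommGroup E]
    [InnerProductSpace ℝ E] {φ : E → ℝ} {g g' u u' : E}
    (h : HasSubgradientAt φ g u) (h' : HasSubgradientAt φ g' u') :
    ⟪g - g', u' - u⟫ ≤ 0 := by
  have h₁ := h u'
  have h₂ := h' u
  rw [← neg_sub u' u, inner_neg_right] at h₂
  rw [inner_sub_left]
  linarith

/-- From the continuous and discrete variational inequalities together with the
subgradient property of `λ` and `λ_h` one gets `γ‖u - u_h‖² ≤ ⟪p - p_h, u_h - u⟫`. -/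
theorem control_error_bound_by_adjoint
    {E : Type*} [NormedAddCommGroup E] [InnerProductSpace ℝ E]
    (K : Set E) (hK : Convex ℝ K) (j₂ : E → ℝ) (hj₂ : ConvexOn ℝ Set.univ j₂)
    (γ β : ℝ) (hγ : 0 < γ) (hβ : 0 ≤ β)
    (u uh : E) (hu : u ∈ K) (huh : uh ∈ K) (p ph lam lamh : E)
    (hlam : HasSubgradientAt j₂ lam u) (hlamh : HasSubgradientAt j₂ lamh uh)
    (hvi : ∀ v ∈ K, 0 ≤ ⟪p + γ • u + β • lam, v - u⟫)
    (hvih : ∀ v ∈ K, 0 ≤ ⟪ph + γ • uh + β • lamh, v - uh⟫) :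
    γ * ‖u - uh‖ ^ 2 ≤ ⟪p - ph, uh - u⟫ := by
  have h₁ := hvi uh huh
  have h₂ := hvih u hu
  have hmono := mul_nonpos_of_nonneg_of_nonpos hβ (hlam.inner_sub_nonpos hlamh)
  have hnorm : ‖u - uh‖ ^ 2 = ⟪uh, uh - u⟫ - ⟪u, uh - u⟫ := by
    rw [← inner_sub_left, real_inner_self_eq_norm_sq, norm_sub_rev]
  rw [← neg_sub uh u, inner_neg_right] at h₂
  simp only [inner_add_left, real_inner_smul_left] at h₁ h₂
  rw [inner_sub_left] at hmono ⊢
  rw [hnorm]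
  linarith
end

section
/- Let (Ω, μ) be a finite measure space, a ≤ b real numbers, U_ad := {v ∈ L²(μ) : a ≤ v(x) ≤ b for μ-a.e. x}, S : L²(μ) → L²(μ) a continuous linear map, f, y_d ∈ L²(μ), γ > 0 and β ≥ 0. Define Ĵ(u) := (1/2)·‖S(u + f) − y_d‖² + (γ/2)·‖u‖² + β·∫ |u| dμ. Then there exists a unique u ∈ U_ad such that Ĵ(u) ≤ Ĵ(v) for all v ∈ U_ad. -/
open MeasureTheory

/-- A continuous function on a nonempty complete set that is bounded below and uniformly midpoint
convex with quadratic modulus has a unique minimizer there. -/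
theorem existsUnique_isMinOn_of_midpoint_strongConvex
    {E : Type*} [NormedAddCommGroup E] [NormedSpace ℝ E] {K : Set E} (hne : K.Nonempty)
    (hK : IsComplete K) (hmid : ∀ x ∈ K, ∀ y ∈ K, (1 / 2 : ℝ) • (x + y) ∈ K)
    {J : E → ℝ} (hcont : Continuous J) (hbdd : BddBelow (J '' K)) {c : ℝ} (hc : 0 < c)
    (hJ : ∀ x ∈ K, ∀ y ∈ K, J ((1 / 2 : ℝ) • (x + y)) + c * ‖x - y‖ ^ 2 ≤ (J x + J y) / 2) :
    ∃! u, u ∈ K ∧ ∀ v ∈ K, J u ≤ J v := by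
  set m := sInf (J '' K) with hm
  have hle : ∀ v ∈ K, m ≤ J v := fun v hv => csInf_le hbdd ⟨v, hv, rfl⟩
  have hseq : ∀ n : ℕ, ∃ x ∈ K, J x < m + 1 / ((n : ℝ) + 1) := fun n => by
    obtain ⟨_, ⟨x, hx, rfl⟩, h⟩ := exists_lt_of_csInf_lt (hne.image J)
      (show sInf (J '' K) < m + 1 / ((n : ℝ) + 1) from lt_add_of_pos_right _ (by positivity))
    exact ⟨x, hx, h⟩
  choose x hxK hx using hseq
  have hlim := tendsto_one_div_add_atTop_nhds_zero_nat (𝕜 := ℝ)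
  have hcauchy : CauchySeq x := by
    refine cauchySeq_of_le_tendsto_0 (fun n : ℕ => √(1 / ((n : ℝ) + 1) / c)) ?_ ?_
    · intro n k N hn hk
      have h1 := hJ _ (hxK n) _ (hxK k)
      have h2 := hle _ (hmid _ (hxK n) _ (hxK k))
      have h3 : 1 / ((n : ℝ) + 1) ≤ 1 / ((N : ℝ) + 1) := by gcongr
      have h4 : 1 / ((k : ℝ) + 1) ≤ 1 / ((N : ℝ) + 1) := by gcongr
      rw [dist_eq_norm]
      apply Real.le_sqrt_of_sq_le
      rw [le_div_iff₀ hc]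
      linarith [hx n, hx k]
    · simpa using ((hlim.div_const c).sqrt)
  obtain ⟨u, huK, hu⟩ := cauchySeq_tendsto_of_isComplete hK hxK hcauchy
  have hJu : J u ≤ m := by
    refine le_of_tendsto_of_tendsto' ((hcont.tendsto u).comp hu) ?_ (fun n => (hx n).le)
    simpa using hlim.const_add m
  refine ⟨u, ⟨huK, fun v hv => hJu.trans (hle v hv)⟩, fun w ⟨hwK, hw⟩ => ?_⟩
  have h1 := hJ _ hwK _ huK
  have h2 := hle _ (hmid _ hwK _ huK)
  have h3 := hw u huK
  have h4 : ‖w - u‖ ^ 2 ≤ 0 := by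
    by_contra! h
    linarith [mul_pos hc h]
  have h5 : ‖w - u‖ = 0 := by
    simpa using le_antisymm h4 (sq_nonneg _)
  exact sub_eq_zero.mp (norm_eq_zero.mp h5)

/-- The parallelogram law in midpoint form. -/
theorem norm_half_smul_add_sq {E : Type*} [NormedAddCommGroup E] [InnerProductSpace ℝ E]
    (x y : E) :
    ‖(1 / 2 : ℝ) • (x + y)‖ ^ 2 = (‖x‖ ^ 2 + ‖y‖ ^ 2) / 2 - ‖x - y‖ ^ 2 / 4 := by
  have h := parallelogram_law_with_norm ℝ x y
  rw [norm_smul, mul_pow, Real.norm_of_nonneg (by norm_num)]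
  linarith

theorem continuous_integral_abs_Lp_two {Ω : Type*} [MeasurableSpace Ω] (μ : Measure Ω)
    [IsFiniteMeasure μ] : Continuous fun u : Lp ℝ 2 μ => ∫ x, |u x| ∂μ := by
  have h : (fun u : Lp ℝ 2 μ => ∫ x, |u x| ∂μ) = fun u : Lp ℝ 2 μ =>
      inner ℝ (indicatorConstLp 2 MeasurableSet.univ (measure_ne_top μ _) (1 : ℝ)) |u| := by
    funext u
    rw [L2.inner_indicatorConstLp_one, setIntegral_univ]
    exact integral_congr_ae (Lp.coeFn_abs u).symm
  rw [h]
  exact continuous_const.inner (continuous_id.sup continuous_neg)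

theorem integral_abs_half_smul_add_le {Ω : Type*} [MeasurableSpace Ω] (μ : Measure Ω)
    [IsFiniteMeasure μ] (u v : Lp ℝ 2 μ) :
    ∫ x, |((1 / 2 : ℝ) • (u + v) : Lp ℝ 2 μ) x| ∂μ ≤
      (∫ x, |u x| ∂μ + ∫ x, |v x| ∂μ) / 2 := by
  have hint : ∀ w : Lp ℝ 2 μ, Integrable (fun x => |w x|) μ := fun w =>
    ((Lp.memLp w).integrable one_le_two).abs
  rw [← integral_add (hint u) (hint v), ← integral_div]
  refine integral_mono_ae (hint _) (((hint u).add (hint v)).div_const 2) ?_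
  filter_upwards [Lp.coeFn_smul (1 / 2 : ℝ) (u + v), Lp.coeFn_add u v] with x h1 h2
  rw [h1, Pi.smul_apply, h2, Pi.add_apply, smul_eq_mul, abs_mul, abs_of_pos (by norm_num)]
  linarith [abs_add_le (u x) (v x)]

theorem setOf_ae_mem_Icc_eq_Icc_const {Ω : Type*} [MeasurableSpace Ω] (μ : Measure Ω)
    [IsFiniteMeasure μ] (a b : ℝ) :
    {v : Lp ℝ 2 μ | ∀ᵐ x ∂μ, a ≤ v x ∧ v x ≤ b} =
      Set.Icc (Lp.const 2 μ a) (Lp.const 2 μ b) := by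
  ext v
  rw [Set.mem_Icc, ← Lp.coeFn_le, ← Lp.coeFn_le, Set.mem_ofPred_eq, Filter.eventually_and]
  have ha := Lp.coeFn_const (p := 2) (μ := μ) a
  have hb := Lp.coeFn_const (p := 2) (μ := μ) b
  refine and_congr (Filter.eventually_congr ?_) (Filter.eventually_congr ?_)
  · filter_upwards [ha] with x hx
    rw [hx, Function.const_apply]
  · filter_upwards [hb] with x hx
    rw [hx, Function.const_apply]

/-- The sparse optimal control problem
`min Ĵ(u) = ½‖S(u+f) - y_d‖² + (γ/2)‖u‖² + β∫|u| dμ` over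
`U_ad = {v ∈ L²(μ) : a ≤ v ≤ b a.e.}` admits a unique minimizer. -/
theorem sparse_control_existsUnique_minimizer
    {Ω : Type*} [MeasurableSpace Ω] (μ : Measure Ω) [IsFiniteMeasure μ]
    (a b : ℝ) (hab : a ≤ b)
    (Uad : Set (Lp ℝ 2 μ))
    (hUad : Uad = {v : Lp ℝ 2 μ | ∀ᵐ x ∂μ, a ≤ v x ∧ v x ≤ b})
    (S : Lp ℝ 2 μ →L[ℝ] Lp ℝ 2 μ) (f yd : Lp ℝ 2 μ)
    (γ β : ℝ) (hγ : 0 < γ) (hβ : 0 ≤ β)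
    (J : Lp ℝ 2 μ → ℝ)
    (hJ : J = fun u : Lp ℝ 2 μ =>
      (1 / 2) * ‖S (u + f) - yd‖ ^ 2 + (γ / 2) * ‖u‖ ^ 2 + β * ∫ x, |u x| ∂μ) :
    ∃! u, u ∈ Uad ∧ ∀ v ∈ Uad, J u ≤ J v := by
  have hclosed : IsClosed Uad := by
    rw [hUad, setOf_ae_mem_Icc_eq_Icc_const]
    exact isClosed_Icc
  have hne : Uad.Nonempty := by
    refine ⟨Lp.const 2 μ a, ?_⟩
    rw [hUad]
    filter_upwards [Lp.coeFn_const (p := 2) (μ := μ) a] with x hx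
    rw [hx]
    exact ⟨le_rfl, hab⟩
  have hmid : ∀ u ∈ Uad, ∀ v ∈ Uad, (1 / 2 : ℝ) • (u + v) ∈ Uad := by
    intro u hu v hv
    rw [hUad] at hu hv ⊢
    filter_upwards [hu, hv, Lp.coeFn_smul (1 / 2 : ℝ) (u + v), Lp.coeFn_add u v]
      with x h1 h2 h3 h4
    rw [h3, Pi.smul_apply, h4, Pi.add_apply, smul_eq_mul]
    constructor <;> linarith [h1.1, h1.2, h2.1, h2.2]
  refine existsUnique_isMinOn_of_midpoint_strongConvex hne hclosed.isComplete hmid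
    (c := γ / 8) ?_ ?_ (by positivity) ?_
  · rw [hJ]
    have := continuous_integral_abs_Lp_two μ
    fun_prop
  · refine ⟨0, ?_⟩
    rintro _ ⟨u, -, rfl⟩
    have : 0 ≤ ∫ x, |u x| ∂μ := integral_nonneg fun x => abs_nonneg _
    rw [hJ]
    positivity
  · intro u _ v _
    have h1 := norm_half_smul_add_sq (S (u + f) - yd) (S (v + f) - yd)
    have h2 := norm_half_smul_add_sq u v
    have h3 := mul_le_mul_of_nonneg_left (integral_abs_half_smul_add_le μ u v) hβ
    have h4 : S ((1 / 2 : ℝ) • (u + v) + f) - yd =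
        (1 / 2 : ℝ) • ((S (u + f) - yd) + (S (v + f) - yd)) := by
      simp only [map_add, map_smul]
      module
    have h5 := sq_nonneg ‖(S (u + f) - yd) - (S (v + f) - yd)‖
    rw [hJ]
    simp only
    rw [h4, h1, h2]
    linarith
end
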